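/- Erasure progress: if the erasure relation ε; ε ⊢ m ~ m' : A is derivable in empty contexts, then either m' is a value or there exists n' such that m' program-reduces in one step to n'. -/

import Mathlib

namespace TLL

/-- The two sorts of TLL: `U` (non-linear) and `L` (linear). -/
inductive Srt : Type
  | U | L
deriving DecidableEq

/-- TLL terms in de Bruijn representation: variables, sorts, the two Π-type
formers (irrelevant `pi0` and relevant `pi1`), the two λ-formers, application,
the erased constant `box`, and heap pointers `ptr`. -/
inductive Tm : Type
  | var  : Nat → Tm
  | srt  : Srt → Tm
  | pi0  : Srt → Tm → Tm → Tm
  | pi1  : Srt → Tm → Tm → Tm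
  | lam0 : Srt → Tm → Tm → Tm
  | lam1 : Srt → Tm → Tm → Tm
  | app  : Tm → Tm → Tm
  | box  : Tm
  | ptr  : Nat → Tm

def upr (ξ : Nat → Nat) : Nat → Nat
  | 0 => 0
  | n + 1 => ξ n + 1

def rename (ξ : Nat → Nat) : Tm → Tm
  | .var x => .var (ξ x)
  | .srt s => .srt s
  | .pi0 t A B => .pi0 t (rename ξ A) (rename (upr ξ) B)
  | .pi1 t A B => .pi1 t (rename ξ A) (rename (upr ξ) B)
  | .lam0 t A m => .lam0 t (rename ξ A) (rename (upr ξ) m)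
  | .lam1 t A m => .lam1 t (rename ξ A) (rename (upr ξ) m)
  | .app m n => .app (rename ξ m) (rename ξ n)
  | .box => .box
  | .ptr l => .ptr l

def up (σ : Nat → Tm) : Nat → Tm
  | 0 => .var 0
  | n + 1 => rename Nat.succ (σ n)

def subst (σ : Nat → Tm) : Tm → Tm
  | .var x => σ x
  | .srt s => .srt s
  | .pi0 t A B => .pi0 t (subst σ A) (subst (up σ) B)
  | .pi1 t A B => .pi1 t (subst σ A) (subst (up σ) B)
  | .lam0 t A m => .lam0 t (subst σ A) (subst (up σ) m)
  | .lam1 t A m => .lam1 t (subst σ A) (subst (up σ) m)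
  | .app m n => .app (subst σ m) (subst σ n)
  | .box => .box
  | .ptr l => .ptr l

/-- `subst1 n m` is `m[n/x]` for the topmost bound variable `x`. -/
def subst1 (n : Tm) (m : Tm) : Tm :=
  subst (fun i => match i with | 0 => n | i + 1 => .var i) m

/-- Logical one-step reduction `m ~> n`: full β-reduction with both β-rules,
closed under all structural subterm positions. -/
inductive LStep : Tm → Tm → Prop
  | beta0 {t A m n} : LStep (.app (.lam0 t A m) n) (subst1 n m)
  | beta1 {t A m n} : LStep (.app (.lam1 t A m) n) (subst1 n m)
  | appL {m m' n} : LStep m m' → LStep (.app m n) (.app m' n)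
  | appR {m n n'} : LStep n n' → LStep (.app m n) (.app m n')
  | pi0A {t A A' B} : LStep A A' → LStep (.pi0 t A B) (.pi0 t A' B)
  | pi0B {t A B B'} : LStep B B' → LStep (.pi0 t A B) (.pi0 t A B')
  | pi1A {t A A' B} : LStep A A' → LStep (.pi1 t A B) (.pi1 t A' B)
  | pi1B {t A B B'} : LStep B B' → LStep (.pi1 t A B) (.pi1 t A B')
  | lam0A {t A A' m} : LStep A A' → LStep (.lam0 t A m) (.lam0 t A' m)
  | lam0M {t A m m'} : LStep m m' → LStep (.lam0 t A m) (.lam0 t A m')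
  | lam1A {t A A' m} : LStep A A' → LStep (.lam1 t A m) (.lam1 t A' m)
  | lam1M {t A m m'} : LStep m m' → LStep (.lam1 t A m) (.lam1 t A m')

/-- Multi-step logical reduction. -/
abbrev LRed : Tm → Tm → Prop := Relation.ReflTransGen LStep

/-- Definitional equality `A ≃ B`: equivalence closure of logical reduction. -/
def Conv (A B : Tm) : Prop := Relation.EqvGen LStep A B

/-- Parallel logical reduction `m ⇒ n`. -/
inductive PStep : Tm → Tm → Prop
  | var {x} : PStep (.var x) (.var x)
  | srt {s} : PStep (.srt s) (.srt s)
  | box : PStep .box .box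
  | ptr {l} : PStep (.ptr l) (.ptr l)
  | pi0 {t A A' B B'} : PStep A A' → PStep B B' → PStep (.pi0 t A B) (.pi0 t A' B')
  | pi1 {t A A' B B'} : PStep A A' → PStep B B' → PStep (.pi1 t A B) (.pi1 t A' B')
  | lam0 {t A A' m m'} : PStep A A' → PStep m m' → PStep (.lam0 t A m) (.lam0 t A' m')
  | lam1 {t A A' m m'} : PStep A A' → PStep m m' → PStep (.lam1 t A m) (.lam1 t A' m')
  | app {m m' n n'} : PStep m m' → PStep n n' → PStep (.app m n) (.app m' n')
  | beta0 {t A m m' n n'} : PStep m m' → PStep n n' →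
      PStep (.app (.lam0 t A m) n) (subst1 n' m')
  | beta1 {t A m m' n n'} : PStep m m' → PStep n n' →
      PStep (.app (.lam1 t A m) n) (subst1 n' m')

/-- Logical contexts: lists of types (de Bruijn). -/
abbrev Ctx := List Tm

/-- `Has Γ x A`: variable `x` has type `A` in logical context `Γ`
(with the appropriate de Bruijn shifts). -/
inductive Has : Ctx → Nat → Tm → Prop
  | zero {Γ A} : Has (A :: Γ) 0 (rename Nat.succ A)
  | succ {Γ x A B} : Has Γ x A → Has (B :: Γ) (x + 1) (rename Nat.succ A)

mutual
/-- Well-formed logical contexts. -/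
inductive LWf : Ctx → Prop
  | nil : LWf []
  | cons {Γ A s} : LWf Γ → LTyped Γ A (.srt s) → LWf (A :: Γ)

/-- The logical typing judgment `Γ ⊢ m : A`. -/
inductive LTyped : Ctx → Tm → Tm → Prop
  | srt {Γ} (s : Srt) : LWf Γ → LTyped Γ (.srt s) (.srt .U)
  | var {Γ x A} : LWf Γ → Has Γ x A → LTyped Γ (.var x) A
  | pi0 {Γ A B s r} (t : Srt) :
      LTyped Γ A (.srt s) → LTyped (A :: Γ) B (.srt r) →
      LTyped Γ (.pi0 t A B) (.srt t)
  | pi1 {Γ A B s r} (t : Srt) :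
      LTyped Γ A (.srt s) → LTyped (A :: Γ) B (.srt r) →
      LTyped Γ (.pi1 t A B) (.srt t)
  | lam0 {Γ A B m} (t : Srt) :
      LTyped (A :: Γ) m B → LTyped Γ (.lam0 t A m) (.pi0 t A B)
  | lam1 {Γ A B m} (t : Srt) :
      LTyped (A :: Γ) m B → LTyped Γ (.lam1 t A m) (.pi1 t A B)
  | app0 {Γ m n A B t} :
      LTyped Γ m (.pi0 t A B) → LTyped Γ n A → LTyped Γ (.app m n) (subst1 n B)
  | app1 {Γ m n A B t} :
      LTyped Γ m (.pi1 t A B) → LTyped Γ n A → LTyped Γ (.app m n) (subst1 n B)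
  | conv {Γ m A B s} :
      LTyped Γ m A → LTyped Γ B (.srt s) → Conv A B → LTyped Γ m B
end

/-- Program context entries: either absent, or a sort-annotated type. -/
abbrev Entry := Option (Srt × Tm)

/-- Program contexts, positionally aligned with the logical context. -/
abbrev PCtx := List Entry

/-- The context constraint `Δ ▷ s`. -/
inductive Restr : PCtx → Srt → Prop
  | nil {s} : Restr [] s
  | skip {Δ s} : Restr Δ s → Restr ((none : Entry) :: Δ) s
  | u {Δ A} : Restr Δ .U → Restr (some (.U, A) :: Δ) .U
  | l {Δ s A} : Restr Δ .L → Restr (some (s, A) :: Δ) .L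

/-- Context merge `Δ₁ ∪̇ Δ₂ = Δ`: contraction on shared `U` entries,
`L` entries occur on exactly one side. -/
inductive Merge : PCtx → PCtx → PCtx → Prop
  | nil : Merge [] [] []
  | contra {Δ₁ Δ₂ Δ A} : Merge Δ₁ Δ₂ Δ →
      Merge (some (.U, A) :: Δ₁) (some (.U, A) :: Δ₂) (some (.U, A) :: Δ)
  | left {Δ₁ Δ₂ Δ A} : Merge Δ₁ Δ₂ Δ →
      Merge (some (.L, A) :: Δ₁) ((none : Entry) :: Δ₂) (some (.L, A) :: Δ)
  | right {Δ₁ Δ₂ Δ A} : Merge Δ₁ Δ₂ Δ →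
      Merge ((none : Entry) :: Δ₁) (some (.L, A) :: Δ₂) (some (.L, A) :: Δ)
  | skip {Δ₁ Δ₂ Δ} : Merge Δ₁ Δ₂ Δ →
      Merge ((none : Entry) :: Δ₁) ((none : Entry) :: Δ₂) ((none : Entry) :: Δ)

/-- `PHas Δ x s A`: the entry `x :s A` occurs in `Δ` and the rest of `Δ`
satisfies `▷ U` (so no linear entry is discarded). -/
inductive PHas : PCtx → Nat → Srt → Tm → Prop
  | zero {Δ s A} : Restr Δ .U → PHas (some (s, A) :: Δ) 0 s (rename Nat.succ A)
  | succN {Δ x s A} : PHas Δ x s A → PHas ((none : Entry) :: Δ) (x + 1) s (rename Nat.succ A)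
  | succU {Δ x s A B} : PHas Δ x s A → PHas (some (.U, B) :: Δ) (x + 1) s (rename Nat.succ A)

/-- Well-formed pairs of logical and program contexts `Γ ; Δ ⊢`. -/
inductive PWf : Ctx → PCtx → Prop
  | nil : PWf [] []
  | cons {Γ Δ A s} : PWf Γ Δ → LTyped Γ A (.srt s) → PWf (A :: Γ) (some (s, A) :: Δ)
  | consN {Γ Δ A s} : PWf Γ Δ → LTyped Γ A (.srt s) → PWf (A :: Γ) ((none : Entry) :: Δ)

/-- The program typing judgment `Γ ; Δ ⊢ m : A`. -/
inductive PTyped : Ctx → PCtx → Tm → Tm → Prop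
  | var {Γ Δ x s A} : PWf Γ Δ → PHas Δ x s A → PTyped Γ Δ (.var x) A
  | lam0 {Γ Δ A B m} (t : Srt) :
      PTyped (A :: Γ) ((none : Entry) :: Δ) m B → Restr Δ t →
      PTyped Γ Δ (.lam0 t A m) (.pi0 t A B)
  | lam1 {Γ Δ A B m s} (t : Srt) :
      PTyped (A :: Γ) (some (s, A) :: Δ) m B → Restr Δ t →
      PTyped Γ Δ (.lam1 t A m) (.pi1 t A B)
  | app0 {Γ Δ m n A B t} :
      PTyped Γ Δ m (.pi0 t A B) → LTyped Γ n A →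
      PTyped Γ Δ (.app m n) (subst1 n B)
  | app1 {Γ Δ₁ Δ₂ Δ m n A B t} :
      PTyped Γ Δ₁ m (.pi1 t A B) → PTyped Γ Δ₂ n A → Merge Δ₁ Δ₂ Δ →
      PTyped Γ Δ (.app m n) (subst1 n B)
  | conv {Γ Δ m A B s} :
      PTyped Γ Δ m A → LTyped Γ B (.srt s) → Conv A B →
      PTyped Γ Δ m B

/-- Program values. -/
inductive Value : Tm → Prop
  | var {x} : Value (.var x)
  | lam0 {t A m} : Value (.lam0 t A m)
  | lam1 {t A m} : Value (.lam1 t A m)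

/-- Program (call-by-value) one-step reduction `m ~~> n`. -/
inductive CStep : Tm → Tm → Prop
  | appL {m m' n} : CStep m m' → CStep (.app m n) (.app m' n)
  | appR {m n n'} : CStep n n' → CStep (.app m n) (.app m n')
  | beta0 {t A m n} : CStep (.app (.lam0 t A m) n) (subst1 n m)
  | beta1 {t A m v} : Value v → CStep (.app (.lam1 t A m) v) (subst1 v m)

/-- The erasure judgment `Γ ; Δ ⊢ m ~ m' : A`. -/
inductive Erase : Ctx → PCtx → Tm → Tm → Tm → Prop
  | var {Γ Δ x s A} : PWf Γ Δ → PHas Δ x s A → Erase Γ Δ (.var x) (.var x) A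
  | lam0 {Γ Δ A B m m'} (t : Srt) :
      Erase (A :: Γ) ((none : Entry) :: Δ) m m' B → Restr Δ t →
      Erase Γ Δ (.lam0 t A m) (.lam0 t .box m') (.pi0 t A B)
  | lam1 {Γ Δ A B m m' s} (t : Srt) :
      Erase (A :: Γ) (some (s, A) :: Δ) m m' B → Restr Δ t →
      Erase Γ Δ (.lam1 t A m) (.lam1 t .box m') (.pi1 t A B)
  | app0 {Γ Δ m m' n A B t} :
      Erase Γ Δ m m' (.pi0 t A B) → LTyped Γ n A →
      Erase Γ Δ (.app m n) (.app m' .box) (subst1 n B)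
  | app1 {Γ Δ₁ Δ₂ Δ m m' n n' A B t} :
      Erase Γ Δ₁ m m' (.pi1 t A B) → Erase Γ Δ₂ n n' A → Merge Δ₁ Δ₂ Δ →
      Erase Γ Δ (.app m n) (.app m' n') (subst1 n B)
  | conv {Γ Δ m m' A B s} :
      Erase Γ Δ m m' A → LTyped Γ B (.srt s) → Conv A B →
      Erase Γ Δ m m' B

/-- Heaps: finite maps from locations to sort-annotated values. -/
abbrev Heap := Nat → Option (Srt × Tm)

/-- Heap lookup `Lookup H₁ l v H₂`: non-linear cells persist, linear cells
are deallocated. -/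
inductive Lookup : Heap → Nat → Tm → Heap → Prop
  | u {H l v} : H l = some (.U, v) → Lookup H l v H
  | l {H l v} : H l = some (.L, v) → Lookup H l v (Function.update H l none)

/-- Heap merge `H₁ ∪̇ H₂ = H`. -/
def HMerge (H₁ H₂ H : Heap) : Prop := ∀ l,
  (H₁ l = none ∧ H₂ l = none ∧ H l = none) ∨
  (∃ v, H₁ l = some (.U, v) ∧ H₂ l = some (.U, v) ∧ H l = some (.U, v)) ∨
  (∃ v, H₁ l = some (.L, v) ∧ H₂ l = none ∧ H l = some (.L, v)) ∨
  (∃ v, H₁ l = none ∧ H₂ l = some (.L, v) ∧ H l = some (.L, v))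

/-- The heap constraint `H ▷ s`. -/
def HRestr (H : Heap) : Srt → Prop
  | .U => ∀ l s v, H l = some (s, v) → s = Srt.U
  | .L => True

/-- Heap reduction `H ; m ~~> H' ; m'`. -/
inductive HStep : Heap → Tm → Heap → Tm → Prop
  | alloc0 {H l t m} : H l = none →
      HStep H (.lam0 t .box m) (Function.update H l (some (t, .lam0 t .box m))) (.ptr l)
  | alloc1 {H l t m} : H l = none →
      HStep H (.lam1 t .box m) (Function.update H l (some (t, .lam1 t .box m))) (.ptr l)
  | appL {H H' m m' n} : HStep H m H' m' → HStep H (.app m n) H' (.app m' n)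
  | appR {H H' m n n'} : HStep H n H' n' → HStep H (.app m n) H' (.app m n')
  | beta0 {H H' l t m n} : Lookup H l (.lam0 t .box m) H' →
      HStep H (.app (.ptr l) n) H' (subst1 .box m)
  | beta1 {H H' l₁ l₂ t m} : Lookup H l₁ (.lam1 t .box m) H' →
      HStep H (.app (.ptr l₁) (.ptr l₂)) H' (subst1 (.ptr l₂) m)

/-- Pointer resolution `H ; m ~ n`. -/
inductive Resolve : Heap → Tm → Tm → Prop
  | var {H x} : HRestr H .U → Resolve H (.var x) (.var x)
  | lam0 {H t m' m} : HRestr H t → Resolve H m' m →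
      Resolve H (.lam0 t .box m') (.lam0 t .box m)
  | lam1 {H t m' m} : HRestr H t → Resolve H m' m →
      Resolve H (.lam1 t .box m') (.lam1 t .box m)
  | app0 {H m' m} : Resolve H m' m → Resolve H (.app m' .box) (.app m .box)
  | app1 {H₁ H₂ H m' m n' n} : HMerge H₁ H₂ H →
      Resolve H₁ m' m → Resolve H₂ n' n → Resolve H (.app m' n') (.app m n)
  | ptr {H H' l v' v} : Lookup H l v' H' → Resolve H' v' v → Resolve H (.ptr l) v

/-- `ClosedUnder k m`: all free de Bruijn variables of `m` are `< k`. -/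
def ClosedUnder : Nat → Tm → Prop
  | k, .var x => x < k
  | _, .srt _ => True
  | k, .pi0 _ A B => ClosedUnder k A ∧ ClosedUnder (k + 1) B
  | k, .pi1 _ A B => ClosedUnder k A ∧ ClosedUnder (k + 1) B
  | k, .lam0 _ A m => ClosedUnder k A ∧ ClosedUnder (k + 1) m
  | k, .lam1 _ A m => ClosedUnder k A ∧ ClosedUnder (k + 1) m
  | k, .app m n => ClosedUnder k m ∧ ClosedUnder k n
  | _, .box => True
  | _, .ptr _ => True

/-- WR-heaps: heaps plausibly produced by heap reduction. -/
inductive WrHeap : Heap → Prop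
  | nil : WrHeap (fun _ => none)
  | lam0 {H l t m} : ClosedUnder 1 m → WrHeap H → H l = none →
      WrHeap (Function.update H l (some (t, .lam0 t .box m)))
  | lam1 {H l t m} : ClosedUnder 1 m → WrHeap H → H l = none →
      WrHeap (Function.update H l (some (t, .lam1 t .box m)))

/-- Well-resolved `H ⊢ a ~ b ~ c : A`. -/
def WellResolved (H : Heap) (a b c A : Tm) : Prop :=
  Erase [] [] a b A ∧ Resolve H c b

/-! ### Renaming and substitution -/

theorem rename_rename (m : Tm) : ∀ ξ ζ : Nat → Nat,
    rename ζ (rename ξ m) = rename (fun x => ζ (ξ x)) m := by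
  have key : ∀ ξ ζ : Nat → Nat, (fun x => upr ζ (upr ξ x)) = upr (fun x => ζ (ξ x)) := by
    intro ξ ζ; funext x; cases x <;> rfl
  induction m <;> intro ξ ζ <;> simp_all [rename]

theorem subst_rename (m : Tm) : ∀ (ξ : Nat → Nat) (σ : Nat → Tm),
    subst σ (rename ξ m) = subst (fun x => σ (ξ x)) m := by
  have key : ∀ (ξ : Nat → Nat) (σ : Nat → Tm),
      (fun x => up σ (upr ξ x)) = up (fun x => σ (ξ x)) := by
    intro ξ σ; funext x; cases x <;> rfl
  induction m <;> intro ξ σ <;> simp_all [rename, subst]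

theorem rename_subst (m : Tm) : ∀ (σ : Nat → Tm) (ξ : Nat → Nat),
    rename ξ (subst σ m) = subst (fun x => rename ξ (σ x)) m := by
  have key : ∀ (σ : Nat → Tm) (ξ : Nat → Nat),
      (fun x => rename (upr ξ) (up σ x)) = up (fun x => rename ξ (σ x)) := by
    intro σ ξ; funext x; cases x with
    | zero => rfl
    | succ x => simp [up, rename_rename, upr]
  induction m <;> intro σ ξ <;> simp_all [rename, subst]

theorem subst_subst (m : Tm) : ∀ σ τ : Nat → Tm,
    subst τ (subst σ m) = subst (fun x => subst τ (σ x)) m := by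
  have key : ∀ σ τ : Nat → Tm,
      (fun x => subst (up τ) (up σ x)) = up (fun x => subst τ (σ x)) := by
    intro σ τ; funext x; cases x with
    | zero => rfl
    | succ x => simp [up, subst_rename, rename_subst]
  induction m <;> intro σ τ <;> simp_all [subst]

theorem subst_var (m : Tm) : subst Tm.var m = m := by
  have key : up Tm.var = Tm.var := by
    funext x; cases x <;> rfl
  induction m <;> simp_all [subst]

theorem rename_subst1 (ξ : Nat → Nat) (n m : Tm) :
    rename ξ (subst1 n m) = subst1 (rename ξ n) (rename (upr ξ) m) := by
  unfold subst1
  rw [rename_subst, subst_rename]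
  congr 1
  funext x; cases x <;> rfl

theorem subst_subst1 (σ : Nat → Tm) (n m : Tm) :
    subst σ (subst1 n m) = subst1 (subst σ n) (subst (up σ) m) := by
  unfold subst1
  rw [subst_subst, subst_subst]
  congr 1
  funext x; cases x with
  | zero => rfl
  | succ x => simp [up, subst_rename, subst, subst_var]

/-! ### Confluence of logical reduction -/

theorem PStep.refl (m : Tm) : PStep m m := by
  induction m <;> constructor <;> assumption

theorem LStep.toPStep {m n : Tm} (h : LStep m n) : PStep m n := by
  induction h <;> constructor <;> first | assumption | exact PStep.refl _

theorem PStep.rename {m n : Tm} (h : PStep m n) :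
    ∀ ξ : Nat → Nat, PStep (rename ξ m) (TLL.rename ξ n) := by
  induction h with
  | beta0 _ _ ihm ihn =>
    intro ξ; rw [rename_subst1]; exact .beta0 (ihm _) (ihn _)
  | beta1 _ _ ihm ihn =>
    intro ξ; rw [rename_subst1]; exact .beta1 (ihm _) (ihn _)
  | _ => intro ξ; constructor <;> apply_assumption

theorem PStep.up {σ τ : Nat → Tm} (h : ∀ x, PStep (σ x) (τ x)) :
    ∀ x, PStep (up σ x) (TLL.up τ x)
  | 0 => .var
  | x + 1 => (h x).rename _

theorem PStep.subst {m n : Tm} (h : PStep m n) :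
    ∀ {σ τ : Nat → Tm}, (∀ x, PStep (σ x) (τ x)) → PStep (subst σ m) (TLL.subst τ n) := by
  induction h with
  | var => intro σ τ hσ; exact hσ _
  | beta0 _ _ ihm ihn =>
    intro σ τ hσ; rw [subst_subst1]; exact .beta0 (ihm (PStep.up hσ)) (ihn hσ)
  | beta1 _ _ ihm ihn =>
    intro σ τ hσ; rw [subst_subst1]; exact .beta1 (ihm (PStep.up hσ)) (ihn hσ)
  | srt | box | ptr => intros; exact PStep.refl _
  | app _ _ ihm ihn => intro σ τ hσ; exact .app (ihm hσ) (ihn hσ)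
  | pi0 _ _ ihA ihB => intro σ τ hσ; exact .pi0 (ihA hσ) (ihB (PStep.up hσ))
  | pi1 _ _ ihA ihB => intro σ τ hσ; exact .pi1 (ihA hσ) (ihB (PStep.up hσ))
  | lam0 _ _ ihA ihm => intro σ τ hσ; exact .lam0 (ihA hσ) (ihm (PStep.up hσ))
  | lam1 _ _ ihA ihm => intro σ τ hσ; exact .lam1 (ihA hσ) (ihm (PStep.up hσ))

theorem PStep.subst1 {m m' n n' : Tm} (hm : PStep m m') (hn : PStep n n') :
    PStep (subst1 n m) (TLL.subst1 n' m') := by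
  refine hm.subst fun x => ?_
  cases x with
  | zero => exact hn
  | succ x => exact .var

/-- Every term has a complete development, to which all its parallel reducts reduce. -/
theorem PStep.exists_complete_development (m : Tm) : ∃ k, ∀ n, PStep m n → PStep n k := by
  induction m with
  | var x => exact ⟨.var x, fun _ h => by cases h; exact .var⟩
  | srt s => exact ⟨.srt s, fun _ h => by cases h; exact .srt⟩
  | box => exact ⟨.box, fun _ h => by cases h; exact .box⟩
  | ptr l => exact ⟨.ptr l, fun _ h => by cases h; exact .ptr⟩
  | pi0 t A B ihA ihB =>
    obtain ⟨A', hA⟩ := ihA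
    obtain ⟨B', hB⟩ := ihB
    exact ⟨.pi0 t A' B', fun _ h => by cases h with | pi0 h₁ h₂ => exact .pi0 (hA _ h₁) (hB _ h₂)⟩
  | pi1 t A B ihA ihB =>
    obtain ⟨A', hA⟩ := ihA
    obtain ⟨B', hB⟩ := ihB
    exact ⟨.pi1 t A' B', fun _ h => by cases h with | pi1 h₁ h₂ => exact .pi1 (hA _ h₁) (hB _ h₂)⟩
  | lam0 t A B ihA ihB =>
    obtain ⟨A', hA⟩ := ihA
    obtain ⟨B', hB⟩ := ihB
    exact ⟨.lam0 t A' B',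
      fun _ h => by cases h with | lam0 h₁ h₂ => exact .lam0 (hA _ h₁) (hB _ h₂)⟩
  | lam1 t A B ihA ihB =>
    obtain ⟨A', hA⟩ := ihA
    obtain ⟨B', hB⟩ := ihB
    exact ⟨.lam1 t A' B',
      fun _ h => by cases h with | lam1 h₁ h₂ => exact .lam1 (hA _ h₁) (hB _ h₂)⟩
  | app m n ihm ihn =>
    obtain ⟨m', hm⟩ := ihm
    obtain ⟨n', hn⟩ := ihn
    by_cases h0 : ∃ t A b, m = .lam0 t A b
    · obtain ⟨t, A, b, rfl⟩ := h0
      cases hm _ (PStep.refl _) with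
      | @lam0 _ _ A' _ b' hA hb =>
        refine ⟨TLL.subst1 n' b', fun x hx => ?_⟩
        cases hx with
        | app h₁ h₂ =>
          cases h₁ with
          | lam0 hA₁ hb₁ =>
            cases hm _ (PStep.lam0 hA₁ hb₁) with
            | lam0 _ hb₂ => exact .beta0 hb₂ (hn _ h₂)
        | beta0 h₁ h₂ =>
          cases hm _ (PStep.lam0 (PStep.refl A) h₁) with
          | lam0 _ hb₂ => exact hb₂.subst1 (hn _ h₂)
    by_cases h1 : ∃ t A b, m = .lam1 t A b
    · obtain ⟨t, A, b, rfl⟩ := h1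
      cases hm _ (PStep.refl _) with
      | @lam1 _ _ A' _ b' hA hb =>
        refine ⟨TLL.subst1 n' b', fun x hx => ?_⟩
        cases hx with
        | app h₁ h₂ =>
          cases h₁ with
          | lam1 hA₁ hb₁ =>
            cases hm _ (PStep.lam1 hA₁ hb₁) with
            | lam1 _ hb₂ => exact .beta1 hb₂ (hn _ h₂)
        | beta1 h₁ h₂ =>
          cases hm _ (PStep.lam1 (PStep.refl A) h₁) with
          | lam1 _ hb₂ => exact hb₂.subst1 (hn _ h₂)
    refine ⟨.app m' n', fun x hx => ?_⟩
    cases hx with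
    | app h₁ h₂ => exact .app (hm _ h₁) (hn _ h₂)
    | beta0 => exact absurd ⟨_, _, _, rfl⟩ h0
    | beta1 => exact absurd ⟨_, _, _, rfl⟩ h1

theorem Conv.join {A B : Tm} (h : Conv A B) :
    Relation.Join (Relation.ReflTransGen PStep) A B := by
  have equiv : Equivalence (Relation.Join (Relation.ReflTransGen PStep)) := by
    refine Relation.equivalence_join_reflTransGen fun a b c hb hc => ?_
    obtain ⟨k, hk⟩ := PStep.exists_complete_development a
    exact ⟨k, .single (hk _ hb), .single (hk _ hc)⟩
  unfold Conv at h
  induction h with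
  | rel _ _ h => exact ⟨_, .single h.toPStep, .refl⟩
  | refl _ => exact equiv.refl _
  | symm _ _ _ ih => exact equiv.symm ih
  | trans _ _ _ _ _ ih₁ ih₂ => exact equiv.trans ih₁ ih₂

theorem not_conv_pi0_pi1 {t s : Srt} {A B A' B' : Tm} :
    ¬ Conv (.pi0 t A B) (.pi1 s A' B') := by
  have red0 : ∀ {C}, Relation.ReflTransGen PStep (.pi0 t A B) C → ∃ A₁ B₁, C = .pi0 t A₁ B₁ := by
    intro C h
    induction h with
    | refl => exact ⟨_, _, rfl⟩
    | tail _ h ih => obtain ⟨_, _, rfl⟩ := ih; cases h; exact ⟨_, _, rfl⟩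
  have red1 : ∀ {C}, Relation.ReflTransGen PStep (.pi1 s A' B') C → ∃ A₁ B₁, C = .pi1 s A₁ B₁ := by
    intro C h
    induction h with
    | refl => exact ⟨_, _, rfl⟩
    | tail _ h ih => obtain ⟨_, _, rfl⟩ := ih; cases h; exact ⟨_, _, rfl⟩
  intro h
  obtain ⟨C, h0, h1⟩ := h.join
  obtain ⟨_, _, rfl⟩ := red0 h0
  obtain ⟨_, _, h⟩ := red1 h1
  cases h

/-! ### Progress -/

/-- Canonical forms: a value erased in the empty program context is a λ-abstraction
whose relevance matches that of its Π-type. -/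
theorem Erase.canonical {Γ : Ctx} {Δ : PCtx} {m m' A : Tm} (h : Erase Γ Δ m m' A)
    (hΔ : Δ = []) (hv : Value m') :
    ((∃ t b, m' = .lam0 t .box b) ∧ ∃ t B C, Conv (.pi0 t B C) A) ∨
      ((∃ t b, m' = .lam1 t .box b) ∧ ∃ t B C, Conv (.pi1 t B C) A) := by
  induction h with
  | var _ hx => subst hΔ; cases hx
  | lam0 => exact .inl ⟨⟨_, _, rfl⟩, _, _, _, .refl _⟩
  | lam1 => exact .inr ⟨⟨_, _, rfl⟩, _, _, _, .refl _⟩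
  | app0 => cases hv
  | app1 => cases hv
  | conv _ _ hc ih =>
    rcases ih hΔ hv with ⟨hm, _, _, _, h⟩ | ⟨hm, _, _, _, h⟩
    · exact .inl ⟨hm, _, _, _, .trans _ _ _ h hc⟩
    · exact .inr ⟨hm, _, _, _, .trans _ _ _ h hc⟩

theorem Erase.progress {Γ : Ctx} {Δ : PCtx} {m m' A : Tm} (h : Erase Γ Δ m m' A)
    (hΔ : Δ = []) : Value m' ∨ ∃ n', CStep m' n' := by
  induction h with
  | var => exact .inl .var
  | lam0 => exact .inl .lam0
  | lam1 => exact .inl .lam1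
  | app0 hm _ ih =>
    rcases ih hΔ with hv | ⟨_, h⟩
    · rcases hm.canonical hΔ hv with ⟨⟨_, _, rfl⟩, -⟩ | ⟨-, _, _, _, hc⟩
      · exact .inr ⟨_, .beta0⟩
      · exact absurd (.symm _ _ hc) not_conv_pi0_pi1
    · exact .inr ⟨_, .appL h⟩
  | app1 hm _ hmerge ihm ihn =>
    subst hΔ
    cases hmerge
    rcases ihm rfl with hv | ⟨_, h⟩
    · rcases hm.canonical rfl hv with ⟨-, _, _, _, hc⟩ | ⟨⟨_, _, rfl⟩, -⟩
      · exact absurd hc not_conv_pi0_pi1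
      · rcases ihn rfl with hw | ⟨_, h⟩
        · exact .inr ⟨_, .beta1 hw⟩
        · exact .inr ⟨_, .appR h⟩
    · exact .inr ⟨_, .appL h⟩
  | conv _ _ _ ih => exact ih hΔ

/-- Erasure progress. -/
theorem erasure_progress {m m' A : Tm}
    (h : Erase [] [] m m' A) :
    Value m' ∨ ∃ n' : Tm, CStep m' n' := by
  exact h.progress rfl
end TLL
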